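/- arXiv:2003.10030 — 3 statements merged into one kernel-verified Lean document; each statement's English description precedes it below -/
import Mathlib

section
/- Let κ be a regular cardinal and let c be a coloring of ^{κ>}ω using fewer than κ colors (i.e., c : ^{κ>}ω → Θ where Θ is a set of cardinality θ < κ). Then there exist ν* ∈ ^{κ>}ω and a color j ∈ Θ such that for every ν ⊵ ν* there exists ρ ⊵ ν with c(ρ) = j. (Lemma 2.11(1).) -/
universe u

/-- Sequences of natural numbers of ordinal length `< κ`: an element of `^{κ>}ω`.
Values beyond the length are normalized to `0`. -/
structure NatSeq (κ : Cardinal.{u}) where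
  len : Ordinal.{u}
  len_lt : len < κ.ord
  val : Ordinal.{u} → ℕ
  val_default : ∀ γ, len ≤ γ → val γ = 0

/-- `η.Ext ν` means `η ⊴ ν`, i.e. `η` is an initial segment of `ν`. -/
def NatSeq.Ext {κ : Cardinal.{u}} (η ν : NatSeq κ) : Prop :=
  η.len ≤ ν.len ∧ ∀ γ < η.len, η.val γ = ν.val γ

theorem NatSeq.Ext.refl {κ : Cardinal.{u}} (η : NatSeq κ) : η.Ext η :=
  ⟨le_rfl, fun _ _ => rfl⟩

theorem NatSeq.Ext.trans {κ : Cardinal.{u}} {η ν ρ : NatSeq κ} (h₁ : η.Ext ν) (h₂ : ν.Ext ρ) :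
    η.Ext ρ :=
  ⟨h₁.1.trans h₂.1, fun γ hγ => (h₁.2 γ hγ).trans (h₂.2 γ (hγ.trans_le h₁.1))⟩

/-- For `κ` regular, a chain of fewer than `κ` sequences has an upper bound. -/
theorem NatSeq.exists_ext_of_chain {κ : Cardinal.{u}} (hκ : κ.IsRegular) {I : Type u}
    (hI : Cardinal.mk I < κ) (F : I → NatSeq κ)
    (hF : ∀ i j, (F i).Ext (F j) ∨ (F j).Ext (F i)) :
    ∃ ν : NatSeq κ, ∀ i, (F i).Ext ν := by
  classical
  have hle : ∀ i, (F i).len ≤ ⨆ i, (F i).len := Ordinal.le_iSup _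
  refine ⟨⟨⨆ i, (F i).len, ?_,
    fun γ => if h : ∃ i, γ < (F i).len then (F h.choose).val γ else 0, ?_⟩, ?_⟩
  · exact Ordinal.iSup_lt_of_lt_cof (by rwa [hκ.cof_ord]) fun i => (F i).len_lt
  · intro γ hγ
    exact dif_neg fun ⟨i, hi⟩ => (hi.trans_le ((hle i).trans hγ)).false
  · refine fun i => ⟨hle i, fun γ hγ => ?_⟩
    have h : ∃ i, γ < (F i).len := ⟨i, hγ⟩
    simp only [dif_pos h]
    rcases hF i h.choose with h' | h'
    · exact h'.2 γ hγ
    · exact (h'.2 γ h.choose_spec).symm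

/-- If `κ` is regular, and each of fewer than `κ` relations `R j` holds at some extension of every
sequence, then there is a sequence above a witness of every `R j`. -/
theorem NatSeq.exists_ext_forall {κ : Cardinal.{u}} (hκ : κ.IsRegular) {Θ : Type u}
    (hΘ : Cardinal.mk Θ < κ) (R : Θ → NatSeq κ → Prop)
    (hR : ∀ (ν : NatSeq κ) j, ∃ ρ : NatSeq κ, ν.Ext ρ ∧ R j ρ) :
    ∃ ν : NatSeq κ, ∀ j, ∃ ρ, R j ρ ∧ ρ.Ext ν := by
  classical
  choose e he heR using hR
  let r : Θ → Θ → Prop := WellOrderingRel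
  have wf : WellFounded r := IsWellFounded.wf
  let ub : (j : Θ) → ((i : Θ) → r i j → NatSeq κ) → NatSeq κ := fun j F =>
    if h : ∃ ν : NatSeq κ, ∀ i hi, (F i hi).Ext ν then h.choose
    else ⟨0, hκ.ord_pos, fun _ => 0, fun _ _ => rfl⟩
  let f : Θ → NatSeq κ := wf.fix fun j F => e (ub j F) j
  have hf : ∀ j, f j = e (ub j fun i _ => f i) j := fun j => wf.fix_eq _ j
  have chain : ∀ j i, r i j → (f i).Ext (f j) := by
    intro j
    induction j using wf.induction with
    | _ j ih =>
      have h : ∃ ν : NatSeq κ, ∀ i, r i j → (f i).Ext ν := by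
        obtain ⟨ν, hν⟩ := NatSeq.exists_ext_of_chain hκ (I := {i // r i j})
          ((Cardinal.mk_subtype_le _).trans_lt hΘ) (fun i => f i) (by
            rintro ⟨a, ha⟩ ⟨b, hb⟩
            rcases trichotomous_of r a b with h | rfl | h
            · exact .inl (ih b hb a h)
            · exact .inl (.refl _)
            · exact .inr (ih a ha b h))
        exact ⟨ν, fun i hi => hν ⟨i, hi⟩⟩
      intro i hi
      rw [hf j]
      refine NatSeq.Ext.trans ?_ (he _ j)
      simp only [ub, dif_pos h]
      exact h.choose_spec i hi
  obtain ⟨ν, hν⟩ := NatSeq.exists_ext_of_chain hκ hΘ f (by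
    intro a b
    rcases trichotomous_of r a b with h | rfl | h
    · exact .inl (chain b a h)
    · exact .inl (.refl _)
    · exact .inr (chain a b h))
  exact ⟨ν, fun j => ⟨f j, by rw [hf j]; exact heR _ _, hν j⟩⟩

/-- Lemma 2.11(1): if `κ` is regular and `c` colors `^{κ>}ω` with fewer than `κ`
colors, then there are `ν*` and a color `j` such that every `ν ⊵ ν*` has an
extension `ρ ⊵ ν` of color `j`. -/
theorem stmt2 {κ : Cardinal.{u}} (hκ : κ.IsRegular) {Θ : Type u}
    (hΘ : Cardinal.mk Θ < κ) (c : NatSeq κ → Θ) :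
    ∃ (νs : NatSeq κ) (j : Θ), ∀ ν : NatSeq κ, νs.Ext ν →
      ∃ ρ : NatSeq κ, ν.Ext ρ ∧ c ρ = j := by
  by_contra! hc
  obtain ⟨ν, hν⟩ := NatSeq.exists_ext_forall hκ hΘ
    (fun j ν => ∀ ρ : NatSeq κ, ν.Ext ρ → c ρ ≠ j) hc
  obtain ⟨ρ, hρ, hρν⟩ := hν (c ν)
  exact hρ ν hρν rfl
end

section
/- Let κ be a regular cardinal and let c be a coloring of ^{κ>}ω using fewer than κ colors (i.e., c : ^{κ>}ω → Θ where Θ is a set of cardinality θ < κ). Then there is a map h : ^{ω>}ω → ^{κ>}ω such that h(η)⌢⟨i⟩ ⊴ h(η⌢⟨i⟩) for every η ∈ ^{ω>}ω and every i < ω, and the range of h is monochromatic, i.e., c(h(η)) = c(h(ν)) for all η, ν ∈ ^{ω>}ω. (Lemma 2.11(2).) -/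
universe u

/-- The empty sequence. -/
def NatSeq.empty {κ : Cardinal.{u}} (hκ : κ.IsRegular) : NatSeq κ where
  len := 0
  len_lt := hκ.ord_pos
  val := fun _ => 0
  val_default := fun _ _ => rfl

/-- A chain of fewer than `κ` sequences of length `< κ` has an upper bound. -/
theorem NatSeq.exists_upper_bound {κ : Cardinal.{u}} (hκ : κ.IsRegular) {ι : Type u}
    (hι : Cardinal.mk ι < κ) (f : ι → NatSeq κ)
    (hf : ∀ i j, (f i).Ext (f j) ∨ (f j).Ext (f i)) :
    ∃ ν : NatSeq κ, ∀ i, (f i).Ext ν := by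
  classical
  have le_sup : ∀ i, (f i).len ≤ ⨆ i, (f i).len := Ordinal.le_iSup _
  refine ⟨⟨⨆ i, (f i).len, ?_,
    fun γ => if h : ∃ i, γ < (f i).len then (f h.choose).val γ else 0, ?_⟩, ?_⟩
  · exact Ordinal.iSup_lt_of_lt_cof (by rwa [hκ.cof_ord]) fun i => (f i).len_lt
  · intro γ hγ
    rw [dif_neg]
    rintro ⟨i, hi⟩
    exact absurd (hi.trans_le (le_sup i)) hγ.not_gt
  · refine fun i => ⟨le_sup i, fun γ hγ => ?_⟩
    have h : ∃ i, γ < (f i).len := ⟨i, hγ⟩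
    simp only [dif_pos h]
    rcases hf i h.choose with h' | h'
    · exact h'.2 γ hγ
    · exact (h'.2 γ h.choose_spec).symm

/-- Some colour is dense above some sequence. -/
theorem NatSeq.exists_dense_color {κ : Cardinal.{u}} (hκ : κ.IsRegular) {Θ : Type u}
    (hΘ : Cardinal.mk Θ < κ) (c : NatSeq κ → Θ) :
    ∃ (t : Θ) (ν : NatSeq κ), ∀ ρ : NatSeq κ, ν.Ext ρ → ∃ σ : NatSeq κ, ρ.Ext σ ∧ c σ = t := by
  by_contra! H
  choose kill ext_kill kill_ne using H
  have hub : ∀ (S : Set Θ) (f : S → NatSeq κ), ∃ ν : NatSeq κ,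
      (∀ i j, (f i).Ext (f j) ∨ (f j).Ext (f i)) → ∀ i, (f i).Ext ν := by
    intro S f
    by_cases hf : ∀ i j, (f i).Ext (f j) ∨ (f j).Ext (f i)
    · obtain ⟨ν, hν⟩ := exists_upper_bound hκ ((Cardinal.mk_set_le S).trans_lt hΘ) f hf
      exact ⟨ν, fun _ => hν⟩
    · exact ⟨empty hκ, fun h => absurd h hf⟩
  choose ub ext_ub using hub
  obtain ⟨_, _⟩ := exists_wellFoundedLT (α := Θ)
  have wf : WellFounded (fun a b : Θ => a < b) := wellFounded_lt
  let f : Θ → NatSeq κ := wf.fix fun t g => kill t (ub (Set.Iio t) fun s => g s.1 s.2)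
  have f_eq : ∀ t, f t = kill t (ub (Set.Iio t) fun s => f s) := fun t => wf.fix_eq _ t
  have mono : ∀ t s, s < t → (f s).Ext (f t) := by
    intro t
    induction t using wf.induction with
    | _ t ih =>
      intro s hs
      rw [f_eq t]
      refine Ext.trans ?_ (ext_kill _ _)
      refine ext_ub (Set.Iio t) (fun s => f s) (fun i j => ?_) ⟨s, hs⟩
      rcases lt_trichotomy i.1 j.1 with h | h | h
      · exact Or.inl (ih _ j.2 _ h)
      · rw [h]
        exact Or.inl (Ext.refl _)
      · exact Or.inr (ih _ i.2 _ h)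
  obtain ⟨ν, hν⟩ := exists_upper_bound hκ hΘ f fun i j => by
    rcases lt_trichotomy i j with h | h | h
    · exact Or.inl (mono _ _ h)
    · rw [h]
      exact Or.inl (Ext.refl _)
    · exact Or.inr (mono _ _ h)
  have h := hν (c ν)
  rw [f_eq] at h
  exact kill_ne _ _ _ h rfl

/-- One-step extension of a sequence by a prescribed entry. -/
theorem NatSeq.exists_snoc {κ : Cardinal.{u}} (hκ : κ.IsRegular) (η : NatSeq κ) (i : ℕ) :
    ∃ ν : NatSeq κ, η.Ext ν ∧ η.len < ν.len ∧ ν.val η.len = i := by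
  classical
  refine ⟨⟨Order.succ η.len, ?_, Function.update η.val η.len i, ?_⟩, ⟨?_, ?_⟩, ?_, ?_⟩
  · exact (Cardinal.isSuccLimit_ord hκ.aleph0_le).succ_lt η.len_lt
  · intro γ hγ
    have h : η.len < γ := Order.succ_le_iff.1 hγ
    rw [Function.update_of_ne h.ne', η.val_default γ h.le]
  · exact Order.le_succ _
  · intro γ hγ
    exact (Function.update_of_ne hγ.ne _ _).symm
  · exact Order.lt_succ _
  · exact Function.update_self _ _ _

/-- Lemma 2.11(2): if `κ` is regular and `c` colors `^{κ>}ω` with fewer than `κ`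
colors, then there is an embedding `h : ^{ω>}ω → ^{κ>}ω` (finite sequences of
naturals are represented by `List ℕ`) such that `h(η)⌢⟨i⟩ ⊴ h(η⌢⟨i⟩)` for every
`i < ω`, and the range of `h` is monochromatic. -/
theorem stmt3 {κ : Cardinal.{u}} (hκ : κ.IsRegular) {Θ : Type u}
    (hΘ : Cardinal.mk Θ < κ) (c : NatSeq κ → Θ) :
    ∃ h : List ℕ → NatSeq κ,
      (∀ (η : List ℕ) (i : ℕ),
        (h η).Ext (h (η ++ [i])) ∧
        (h η).len < (h (η ++ [i])).len ∧
        (h (η ++ [i])).val (h η).len = i) ∧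
      (∀ η ν : List ℕ, c (h η) = c (h ν)) := by
  obtain ⟨t, ν, dense⟩ := NatSeq.exists_dense_color hκ hΘ c
  have step : ∀ (i : ℕ) (η : {η : NatSeq κ // ν.Ext η ∧ c η = t}),
      ∃ ρ : {ρ : NatSeq κ // ν.Ext ρ ∧ c ρ = t},
        η.1.Ext ρ.1 ∧ η.1.len < ρ.1.len ∧ ρ.1.val η.1.len = i := by
    rintro i ⟨η, hη, -⟩
    obtain ⟨ρ, hρ, hlen, hval⟩ := NatSeq.exists_snoc hκ η i
    obtain ⟨σ, hσ, hc⟩ := dense ρ (hη.trans hρ)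
    exact ⟨⟨σ, (hη.trans hρ).trans hσ, hc⟩, hρ.trans hσ, hlen.trans_le hσ.1,
      (hσ.2 _ hlen).symm.trans hval⟩
  choose next hnext using step
  obtain ⟨σ, hσ, hc⟩ := dense ν (NatSeq.Ext.refl ν)
  let g : List ℕ → {η : NatSeq κ // ν.Ext η ∧ c η = t} :=
    fun l => l.foldl (fun η i => next i η) ⟨σ, hσ, hc⟩
  refine ⟨fun l => (g l).1, fun η i => ?_, fun η ρ => (g η).2.2.trans (g ρ).2.2.symm⟩
  have h : g (η ++ [i]) = next i (g η) := by simp [g]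
  simp only [h]
  exact hnext i (g η)
end

section
/- Suppose ⟨σ₀,…,σₙ⟩ ≈_γ ⟨τ₀,…,τₙ⟩ are tuples of nonempty finite binary strings. Then for all i, j, k, l ≤ n: σᵢ⁻∧σⱼ⁻ ⊴ σ_k⁻∧σ_l⁻ if and only if τᵢ⁻∧τⱼ⁻ ⊴ τ_k⁻∧τ_l⁻. (Subclaim 1 in the proof of Lemma 3.6.) -/
/-- The meet `η ∧ ν` of two finite binary strings: their longest common prefix. -/
def lcp : List Bool → List Bool → List Bool
  | a :: as, b :: bs => if a = b then a :: lcp as bs else []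
  | _, _ => []

/-- `η ⊥ ν`: the strings are incomparable (neither is a prefix of the other). -/
def Incomp (a b : List Bool) : Prop := ¬ a <+: b ∧ ¬ b <+: a

/-- A tuple of strings is ∧-closed if the meet of any two entries is again an entry. -/
def MeetClosed {ι : Type*} (t : ι → List Bool) : Prop :=
  ∀ i j : ι, ∃ k : ι, lcp (t i) (t j) = t k

/-- `s ≈_α t`: both tuples are ∧-closed, and they satisfy the same
`⊴`-relations and the same `⌢⟨d⟩⊴`-relations between entries. -/
def EqvA {ι : Type*} (s t : ι → List Bool) : Prop :=
  MeetClosed s ∧ MeetClosed t ∧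
  (∀ i j : ι, s i <+: s j ↔ t i <+: t j) ∧
  (∀ (i j : ι) (d : Bool), s i ++ [d] <+: s j ↔ t i ++ [d] <+: t j)

/-- `s ≈_β t`: `≈_α` together with preservation of the relation `ηᵢ⌢⟨1⟩ = ηⱼ`. -/
def EqvB {ι : Type*} (s t : ι → List Bool) : Prop :=
  EqvA s t ∧ ∀ i j : ι, s i ++ [true] = s j ↔ t i ++ [true] = t j

/-- `s ≈_γ t`: `≈_β` together with preservation of `ηᵢ⌢⟨0⟩ = ηⱼ` and of
ending with `0` resp. with `1`. -/
def EqvG {ι : Type*} (s t : ι → List Bool) : Prop :=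
  EqvB s t ∧
  (∀ i j : ι, s i ++ [false] = s j ↔ t i ++ [false] = t j) ∧
  (∀ i : ι, (s i).getLast? = some false ↔ (t i).getLast? = some false) ∧
  (∀ i : ι, (s i).getLast? = some true ↔ (t i).getLast? = some true)

/-- The meet-closure tuple of a tuple of strings: all pairwise meets. -/
def cl {ι : Type*} (t : ι → List Bool) : ι × ι → List Bool :=
  fun p => lcp (t p.1) (t p.2)

theorem prefix_lcp_iff (x a b : List Bool) : x <+: lcp a b ↔ x <+: a ∧ x <+: b := by
  induction x generalizing a b with
  | nil => simp
  | cons c x ih =>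
    cases a with
    | nil => simp [lcp]
    | cons a as =>
      cases b with
      | nil => simp [lcp]
      | cons b bs =>
        by_cases hab : a = b
        · subst hab
          simp only [lcp, if_true, List.cons_prefix_cons, ih]
          tauto
        · simp only [lcp, if_neg hab, List.cons_prefix_cons]
          constructor
          · intro h
            simp at h
          · rintro ⟨⟨rfl, -⟩, rfl, -⟩
            exact absurd rfl hab

theorem List.IsPrefix.antisymm {a b : List Bool} (hab : a <+: b) (hba : b <+: a) : a = b :=
  hab.eq_of_length_le hba.length_le

theorem lcp_eq_of_prefix_iff {a b c : List Bool}
    (h : ∀ x, x <+: c ↔ x <+: a ∧ x <+: b) : lcp a b = c :=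
  List.IsPrefix.antisymm ((h _).2 ((prefix_lcp_iff _ _ _).1 (List.prefix_refl _)))
    ((prefix_lcp_iff _ _ _).2 ((h _).1 (List.prefix_refl _)))

theorem prefix_dropLast_iff {a b : List Bool} (hb : b ≠ []) :
    a <+: b.dropLast ↔ a <+: b ∧ ¬ b <+: a := by
  have hpos := List.length_pos_iff.2 hb
  constructor
  · intro h
    refine ⟨h.trans (List.dropLast_prefix b), fun h' => ?_⟩
    have h₁ := h.length_le
    have h₂ := h'.length_le
    rw [List.length_dropLast] at h₁
    omega
  · rintro ⟨h, h'⟩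
    refine List.prefix_of_prefix_length_le h (List.dropLast_prefix b) ?_
    rw [List.length_dropLast]
    by_contra hlt
    exact h' ((h.eq_of_length_le (by omega)) ▸ List.prefix_refl _)

theorem dropLast_prefix_dropLast {a b : List Bool} (h : a <+: b) :
    a.dropLast <+: b.dropLast := by
  by_cases ha : a = []
  · simp [ha]
  have hb : b ≠ [] := fun hb => ha (List.prefix_nil.1 (hb ▸ h))
  have hpos := List.length_pos_iff.2 ha
  refine (prefix_dropLast_iff hb).2 ⟨(List.dropLast_prefix a).trans h, fun h' => ?_⟩
  have h₁ := h.length_le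
  have h₂ := h'.length_le
  rw [List.length_dropLast] at h₂
  omega

/-- The meet of `a⁻` and `b⁻` when `a` and `b` are comparable. -/
theorem lcp_dropLast_of_le {a b : List Bool} (h : a <+: b) :
    lcp a.dropLast b.dropLast = a.dropLast :=
  lcp_eq_of_prefix_iff fun _ =>
    ⟨fun hx => ⟨hx, hx.trans (dropLast_prefix_dropLast h)⟩, fun hx => hx.1⟩

theorem lcp_comm (a b : List Bool) : lcp a b = lcp b a :=
  lcp_eq_of_prefix_iff fun x => by rw [prefix_lcp_iff, and_comm]

/-- The meet of `a⁻` and `b⁻` when `a` and `b` are incomparable. -/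
theorem lcp_dropLast_of_incomp {a b : List Bool} (h : Incomp a b) :
    lcp a.dropLast b.dropLast = lcp a b := by
  have ha : a ≠ [] := fun ha => h.1 (ha ▸ List.nil_prefix)
  have hb : b ≠ [] := fun hb => h.2 (hb ▸ List.nil_prefix)
  refine lcp_eq_of_prefix_iff fun x => ?_
  rw [prefix_lcp_iff, prefix_dropLast_iff ha, prefix_dropLast_iff hb]
  exact ⟨fun hx => ⟨⟨hx.1, fun hax => h.1 (hax.trans hx.2)⟩, hx.2,
      fun hbx => h.2 (hbx.trans hx.1)⟩,
    fun hx => ⟨hx.1.1, hx.2.1⟩⟩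

theorem MeetClosed.dropLast_prefix_dropLast_iff {ι : Type*} {s : ι → List Bool}
    (hs : MeetClosed s) (hne : ∀ i, s i ≠ []) (m p : ι) :
    (s m).dropLast <+: (s p).dropLast ↔
      s m <+: s p ∨ ∃ q d, s q ++ [d] = s m ∧ s q <+: s p ∧ ¬ s p <+: s q := by
  constructor
  · intro h
    by_cases hmp : s m <+: s p
    · exact Or.inl hmp
    obtain ⟨q, hq⟩ := hs m p
    have hqmp := (prefix_lcp_iff (s q) (s m) (s p)).1 (hq ▸ List.prefix_refl _)
    have hle : (s m).dropLast <+: s q := hq ▸ (prefix_lcp_iff _ _ _).2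
      ⟨List.dropLast_prefix _, h.trans (List.dropLast_prefix _)⟩
    have hge : s q <+: (s m).dropLast :=
      (prefix_dropLast_iff (hne m)).2 ⟨hqmp.1, fun h' => hmp (h'.trans hqmp.2)⟩
    have heq : s q = (s m).dropLast := List.IsPrefix.antisymm hge hle
    refine Or.inr ⟨q, (s m).getLast (hne m), ?_, ?_⟩
    · rw [heq, List.dropLast_append_getLast]
    · rw [heq]
      exact (prefix_dropLast_iff (hne p)).1 h
  · rintro (h | ⟨q, d, hqm, hqp⟩)
    · exact dropLast_prefix_dropLast h
    · rw [← hqm, List.dropLast_concat]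
      exact (prefix_dropLast_iff (hne p)).2 hqp

theorem EqvA.lcp_eq {ι : Type*} {s t : ι → List Bool} (h : EqvA s t) {i j m : ι}
    (hm : lcp (s i) (s j) = s m) : lcp (t i) (t j) = t m := by
  obtain ⟨-, ht, hst, -⟩ := h
  obtain ⟨m', hm'⟩ := ht i j
  have hs := (prefix_lcp_iff (s m) (s i) (s j)).1 (hm ▸ List.prefix_refl _)
  have ht' := (prefix_lcp_iff (t m') (t i) (t j)).1 (hm' ▸ List.prefix_refl _)
  rw [hm']
  refine List.IsPrefix.antisymm ((hst _ _).1 ?_) ?_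
  · rw [← hm]
    exact (prefix_lcp_iff _ _ _).2 ⟨(hst _ _).2 ht'.1, (hst _ _).2 ht'.2⟩
  · rw [← hm']
    exact (prefix_lcp_iff _ _ _).2 ⟨(hst _ _).1 hs.1, (hst _ _).1 hs.2⟩

/-- Subclaim 1 in the proof of Lemma 3.6. -/
theorem stmt7 {n : ℕ} (σ τ : Fin (n + 1) → List Bool)
    (hσne : ∀ i, σ i ≠ []) (hτne : ∀ i, τ i ≠ [])
    (h : EqvG σ τ) :
    ∀ i j k l : Fin (n + 1),
      (lcp ((σ i).dropLast) ((σ j).dropLast) <+: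
        lcp ((σ k).dropLast) ((σ l).dropLast)) ↔
      (lcp ((τ i).dropLast) ((τ j).dropLast) <+:
        lcp ((τ k).dropLast) ((τ l).dropLast)) := by
  obtain ⟨⟨hA, h1⟩, h0, -, -⟩ := h
  have hpre := hA.2.2.1
  have hsucc : ∀ (i j : Fin (n + 1)) (d : Bool), σ i ++ [d] = σ j ↔ τ i ++ [d] = τ j := by
    rintro i j (_ | _)
    exacts [h0 i j, h1 i j]
  have hdrop (m p : Fin (n + 1)) :
      (σ m).dropLast <+: (σ p).dropLast ↔ (τ m).dropLast <+: (τ p).dropLast := by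
    rw [hA.1.dropLast_prefix_dropLast_iff hσne, hA.2.1.dropLast_prefix_dropLast_iff hτne]
    simp only [hpre, hsucc]
  intro i j k l
  by_cases hij : σ i <+: σ j
  · rw [lcp_dropLast_of_le hij, lcp_dropLast_of_le ((hpre i j).1 hij),
      prefix_lcp_iff, prefix_lcp_iff, hdrop, hdrop]
  by_cases hji : σ j <+: σ i
  · rw [lcp_comm (σ i).dropLast, lcp_comm (τ i).dropLast,
      lcp_dropLast_of_le hji, lcp_dropLast_of_le ((hpre j i).1 hji),
      prefix_lcp_iff, prefix_lcp_iff, hdrop, hdrop]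
  obtain ⟨m, hm⟩ := hA.1 i j
  rw [lcp_dropLast_of_incomp ⟨hij, hji⟩,
    lcp_dropLast_of_incomp ⟨mt (hpre i j).2 hij, mt (hpre j i).2 hji⟩, hm, hA.lcp_eq hm,
    prefix_lcp_iff, prefix_lcp_iff, prefix_dropLast_iff (hσne k), prefix_dropLast_iff (hσne l),
    prefix_dropLast_iff (hτne k), prefix_dropLast_iff (hτne l)]
  simp only [hpre]
end
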